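/- arXiv:2509.08775 — 2 statements merged into one kernel-verified Lean document; each statement's English description precedes it below -/
import Mathlib

section
/- Fix n : ℕ, α ∈ (0,1), and let p₀ : ℝⁿ → [0,∞) be a probability density (measurable, nonnegative, with ∫ p₀ dy₀ = 1 for Lebesgue measure). Then the noisy marginal p_i(y) := ∫ K_α(y ∣ y₀) p₀(y₀) dy₀ is differentiable at every y ∈ ℝⁿ with gradient obtained by differentiating under the integral, gradient p_i y = ∫ s_α(y₀ ∣ y) · K_α(y ∣ y₀) · p₀(y₀) dy₀, and consequently the score of the noisy marginal equals the posterior expectation of the Tweedie score: gradient (fun y => Real.log (p_i y)) y = ∫ s_α(y₀ ∣ y) · p_{0|i}(y₀ ∣ y) dy₀. -/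
open MeasureTheory

/-- The forward Gaussian kernel
`K_α(y ∣ y₀) = (2π(1−α))^(−n/2) · exp(−‖y − √α·y₀‖² / (2(1−α)))`. -/
noncomputable def fwdK (n : ℕ) (α : ℝ) (y y₀ : EuclideanSpace ℝ (Fin n)) : ℝ :=
  (2 * Real.pi * (1 - α)) ^ (-(n : ℝ) / 2) *
    Real.exp (-‖y - Real.sqrt α • y₀‖ ^ 2 / (2 * (1 - α)))

/-- The Tweedie score of the forward kernel,
`s_α(y₀ ∣ y) = −(y − √α·y₀)/(1−α)`. -/
noncomputable def tweedieScore (n : ℕ) (α : ℝ) (y₀ y : EuclideanSpace ℝ (Fin n)) :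
    EuclideanSpace ℝ (Fin n) :=
  -((1 - α)⁻¹ • (y - Real.sqrt α • y₀))

lemma fwdK_pos {n : ℕ} {α : ℝ} (hα : α ∈ Set.Ioo (0 : ℝ) 1) (y y₀ : EuclideanSpace ℝ (Fin n)) :
    0 < fwdK n α y y₀ := by
  have hv : 0 < 1 - α := sub_pos.2 hα.2
  unfold fwdK
  positivity

lemma fwdK_le {n : ℕ} {α : ℝ} (hα : α ∈ Set.Ioo (0 : ℝ) 1) (y y₀ : EuclideanSpace ℝ (Fin n)) :
    fwdK n α y y₀ ≤ (2 * Real.pi * (1 - α)) ^ (-(n : ℝ) / 2) := by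
  have hv : 0 < 1 - α := sub_pos.2 hα.2
  unfold fwdK
  refine mul_le_of_le_one_right (by positivity) (Real.exp_le_one_iff.2 ?_)
  rw [neg_div]
  exact neg_nonpos.2 (by positivity)

lemma continuous_fwdK (n : ℕ) (α : ℝ) (y : EuclideanSpace ℝ (Fin n)) :
    Continuous (fwdK n α y) := by
  unfold fwdK
  fun_prop

lemma continuous_tweedieScore (n : ℕ) (α : ℝ) (y : EuclideanSpace ℝ (Fin n)) :
    Continuous fun y₀ => tweedieScore n α y₀ y := by
  unfold tweedieScore
  fun_prop

lemma hasGradientAt_fwdK (n : ℕ) (α : ℝ) (y y₀ : EuclideanSpace ℝ (Fin n)) :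
    HasGradientAt (fun y' => fwdK n α y' y₀) (fwdK n α y y₀ • tweedieScore n α y₀ y) y := by
  have h := ((((hasStrictFDerivAt_norm_sq (y - Real.sqrt α • y₀)).hasFDerivAt.comp y
    ((hasFDerivAt_id y).sub_const (Real.sqrt α • y₀))).neg.mul_const
      (2 * (1 - α))⁻¹).exp).const_mul ((2 * Real.pi * (1 - α)) ^ (-(n : ℝ) / 2))
  rw [hasGradientAt_iff_hasFDerivAt]
  refine h.congr_fderiv ?_
  ext w
  simp [fwdK, tweedieScore, div_eq_mul_inv]
  ring

lemma norm_fwdK_smul_tweedieScore_le {n : ℕ} {α : ℝ} (hα : α ∈ Set.Ioo (0 : ℝ) 1)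
    (y y₀ : EuclideanSpace ℝ (Fin n)) :
    ‖fwdK n α y y₀ • tweedieScore n α y₀ y‖ ≤
      (2 * Real.pi * (1 - α)) ^ (-(n : ℝ) / 2) * (1 - α)⁻¹ := by
  have hv : 0 < 1 - α := sub_pos.2 hα.2
  rw [norm_smul, Real.norm_of_nonneg (fwdK_pos hα y y₀).le, tweedieScore, norm_neg, norm_smul,
    Real.norm_of_nonneg (inv_nonneg.2 hv.le), fwdK]
  set t := ‖y - Real.sqrt α • y₀‖
  have ht : t ≤ Real.exp (t ^ 2 / (2 * (1 - α))) := by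
    have h₁ : t ^ 2 / 2 ≤ t ^ 2 / (2 * (1 - α)) := by
      gcongr
      linarith [hα.1]
    linarith [Real.add_one_le_exp (t ^ 2 / (2 * (1 - α))), sq_nonneg (t - 1)]
  have hexp : Real.exp (-t ^ 2 / (2 * (1 - α))) * t ≤ 1 := by
    rw [neg_div, Real.exp_neg, inv_mul_le_iff₀ (Real.exp_pos _), mul_one]
    exact ht
  calc _ = (2 * Real.pi * (1 - α)) ^ (-(n : ℝ) / 2) * (1 - α)⁻¹ *
        (Real.exp (-t ^ 2 / (2 * (1 - α))) * t) := by ring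
    _ ≤ _ := mul_le_of_le_one_right (by positivity) hexp

lemma integrable_fwdK_mul {n : ℕ} {α : ℝ} (hα : α ∈ Set.Ioo (0 : ℝ) 1)
    {p₀ : EuclideanSpace ℝ (Fin n) → ℝ} (hp₀ : Integrable p₀) (y : EuclideanSpace ℝ (Fin n)) :
    Integrable fun y₀ => fwdK n α y y₀ * p₀ y₀ :=
  hp₀.bdd_mul (continuous_fwdK n α y).aestronglyMeasurable <| ae_of_all _ fun y₀ => by
    rw [Real.norm_of_nonneg (fwdK_pos hα y y₀).le]
    exact fwdK_le hα y y₀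

lemma integral_fwdK_mul_pos {n : ℕ} {α : ℝ} (hα : α ∈ Set.Ioo (0 : ℝ) 1)
    {p₀ : EuclideanSpace ℝ (Fin n) → ℝ} (hp₀ : Integrable p₀) (hp₀_nonneg : ∀ y₀, 0 ≤ p₀ y₀)
    (hp₀_pos : 0 < ∫ y₀, p₀ y₀) (y : EuclideanSpace ℝ (Fin n)) :
    0 < ∫ y₀, fwdK n α y y₀ * p₀ y₀ := by
  rw [integral_pos_iff_support_of_nonneg
    (fun y₀ => mul_nonneg (fwdK_pos hα y y₀).le (hp₀_nonneg y₀)) (integrable_fwdK_mul hα hp₀ y),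
    Function.support_mul, Function.support_eq_univ fun y₀ => (fwdK_pos hα y y₀).ne',
    Set.univ_inter]
  exact (integral_pos_iff_support_of_nonneg hp₀_nonneg hp₀).1 hp₀_pos

/-- A weighted Gaussian convolution can be differentiated under the integral sign. -/
lemma hasGradientAt_integral_fwdK_mul {n : ℕ} {α : ℝ} (hα : α ∈ Set.Ioo (0 : ℝ) 1)
    {p₀ : EuclideanSpace ℝ (Fin n) → ℝ} (hp₀ : Integrable p₀) (y : EuclideanSpace ℝ (Fin n)) :
    HasGradientAt (fun y' => ∫ y₀, fwdK n α y' y₀ * p₀ y₀)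
      (∫ y₀, (fwdK n α y y₀ * p₀ y₀) • tweedieScore n α y₀ y) y := by
  let g : EuclideanSpace ℝ (Fin n) → EuclideanSpace ℝ (Fin n) → EuclideanSpace ℝ (Fin n) :=
    fun y y₀ => (fwdK n α y y₀ * p₀ y₀) • tweedieScore n α y₀ y
  have hg_le (y y₀ : EuclideanSpace ℝ (Fin n)) : ‖g y y₀‖ ≤
      (2 * Real.pi * (1 - α)) ^ (-(n : ℝ) / 2) * (1 - α)⁻¹ * ‖p₀ y₀‖ := by
    simp only [g]
    rw [mul_comm (fwdK n α y y₀), mul_smul, norm_smul, mul_comm]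
    exact mul_le_mul_of_nonneg_right (norm_fwdK_smul_tweedieScore_le hα y y₀) (norm_nonneg _)
  have hg_meas : AEStronglyMeasurable (g y) :=
    (integrable_fwdK_mul hα hp₀ y).aestronglyMeasurable.smul
      (continuous_tweedieScore n α y).aestronglyMeasurable
  have hbound : Integrable fun y₀ : EuclideanSpace ℝ (Fin n) =>
      (2 * Real.pi * (1 - α)) ^ (-(n : ℝ) / 2) * (1 - α)⁻¹ * ‖p₀ y₀‖ :=
    hp₀.norm.const_mul _
  have hg_int : Integrable (g y) := hbound.mono' hg_meas (ae_of_all _ (hg_le y))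
  have hdual_meas : AEStronglyMeasurable fun y₀ => InnerProductSpace.toDual ℝ _ (g y y₀) :=
    (InnerProductSpace.toDual ℝ _).continuous.comp_aestronglyMeasurable hg_meas
  have hdual_le (y y₀ : EuclideanSpace ℝ (Fin n)) : ‖InnerProductSpace.toDual ℝ _ (g y y₀)‖ ≤
      (2 * Real.pi * (1 - α)) ^ (-(n : ℝ) / 2) * (1 - α)⁻¹ * ‖p₀ y₀‖ := by
    rw [LinearIsometryEquiv.norm_map]
    exact hg_le y y₀
  have hdual_int : Integrable fun y₀ => InnerProductSpace.toDual ℝ _ (g y y₀) :=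
    hbound.mono' hdual_meas (ae_of_all _ (hdual_le y))
  have h := hasFDerivAt_integral_of_dominated_of_fderiv_le
    (F := fun y y₀ => fwdK n α y y₀ * p₀ y₀)
    (F' := fun y y₀ => InnerProductSpace.toDual ℝ _ (g y y₀))
    Filter.univ_mem
    (Filter.Eventually.of_forall fun y' => (integrable_fwdK_mul hα hp₀ y').aestronglyMeasurable)
    (integrable_fwdK_mul hα hp₀ y) hdual_meas
    (ae_of_all _ fun y₀ y' _ => hdual_le y' y₀) hbound
    (ae_of_all _ fun y₀ y' _ => by
      refine ((hasGradientAt_fwdK n α y' y₀).hasFDerivAt.mul_const (p₀ y₀)).congr_fderiv ?_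
      ext w
      simp [g]
      ring)
  rw [hasGradientAt_iff_hasFDerivAt]
  refine h.congr_fderiv ?_
  ext w
  rw [ContinuousLinearMap.integral_apply hdual_int, InnerProductSpace.toDual_apply_apply,
    real_inner_comm, ← integral_inner hg_int]
  simp only [InnerProductSpace.toDual_apply_apply, real_inner_comm]

lemma HasGradientAt.log {E : Type*} [NormedAddCommGroup E] [InnerProductSpace ℝ E]
    [CompleteSpace E] {f : E → ℝ} {f' x : E} (hf : HasGradientAt f f' x) (hx : f x ≠ 0) :
    HasGradientAt (fun x => Real.log (f x)) ((f x)⁻¹ • f') x := by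
  rw [hasGradientAt_iff_hasFDerivAt]
  refine (hf.hasFDerivAt.log hx).congr_fderiv ?_
  simp

/-- If `p₀` is a probability density on ℝⁿ, then the noisy marginal
`p_i(y) = ∫ K_α(y ∣ y₀) p₀(y₀) dy₀` is differentiable at every `y` with gradient obtained
by differentiating under the integral,
`∇ p_i (y) = ∫ s_α(y₀ ∣ y) K_α(y ∣ y₀) p₀(y₀) dy₀`, and consequently the score of the noisy
marginal equals the posterior expectation of the Tweedie score:
`∇ (log p_i) (y) = ∫ s_α(y₀ ∣ y) p_{0|i}(y₀ ∣ y) dy₀`, where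
`p_{0|i}(y₀ ∣ y) = K_α(y ∣ y₀) p₀(y₀) / p_i(y)`. -/
theorem noisyMarginal_differentiable_gradient_and_score
    (n : ℕ) (α : ℝ) (hα : α ∈ Set.Ioo (0 : ℝ) 1)
    (p₀ : EuclideanSpace ℝ (Fin n) → ℝ)
    (hp₀_meas : Measurable p₀) (hp₀_nonneg : ∀ y₀, 0 ≤ p₀ y₀)
    (hp₀_one : (∫ y₀, p₀ y₀) = 1) :
    ∀ y : EuclideanSpace ℝ (Fin n),
      DifferentiableAt ℝ (fun y' => ∫ y₀, fwdK n α y' y₀ * p₀ y₀) y ∧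
      gradient (fun y' => ∫ y₀, fwdK n α y' y₀ * p₀ y₀) y
        = ∫ y₀, (fwdK n α y y₀ * p₀ y₀) • tweedieScore n α y₀ y ∧
      gradient (fun y' => Real.log (∫ y₀, fwdK n α y' y₀ * p₀ y₀)) y
        = ∫ y₀, ((fwdK n α y y₀ * p₀ y₀) / (∫ y₀', fwdK n α y y₀' * p₀ y₀'))
            • tweedieScore n α y₀ y := by
  intro y
  have hp₀ : Integrable p₀ := by
    by_contra h
    simp [integral_undef h] at hp₀_one
  have hgrad := hasGradientAt_integral_fwdK_mul hα hp₀ y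
  have hpos := integral_fwdK_mul_pos hα hp₀ hp₀_nonneg (by rw [hp₀_one]; exact one_pos) y
  refine ⟨hgrad.differentiableAt, hgrad.gradient, ?_⟩
  rw [(hgrad.log hpos.ne').gradient, ← integral_smul]
  simp only [smul_smul, div_eq_inv_mul]
end

section
/- (Theorem 1: Joint score approximation using importance sampling.) Under the joint JM2D setup, fix a noisy point (x,k) with p_iˣ(x) > 0 and p_i(x,k) > 0. Assume the joint noisy density p_i is differentiable at (x,k) with gradient obtained by differentiating under the integral, gradient p_i (x,k) = ∬ (sˣ(x₀ ∣ x), sᵏ(k₀ ∣ k)) · Kˣ(x ∣ x₀)·Kᵏ(k ∣ k₀)·p₀(x₀,k₀) dx₀ dk₀, where sˣ(x₀ ∣ x) := −(x − √αˣ·x₀)/(1−αˣ) and sᵏ(k₀ ∣ k) := −(k − √αᵏ·k₀)/(1−αᵏ). Assume further that (x₀,k₀) ↦ V(x₀,k₀)·p₀ᵏ(k₀)·q(x₀,k₀ ∣ x,k) and (x₀,k₀) ↦ (sˣ(x₀ ∣ x), sᵏ(k₀ ∣ k))·V(x₀,k₀)·p₀ᵏ(k₀)·q(x₀,k₀ ∣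 x,k) are integrable, with ∬ V·p₀ᵏ·q > 0. Then the joint score equals the importance-weighted ratio: gradient (fun (x,k) => Real.log (p_i (x,k))) (x,k) = (∬ (sˣ(x₀ ∣ x), sᵏ(k₀ ∣ k)) · V(x₀,k₀)·p₀ᵏ(k₀) · q(x₀,k₀ ∣ x,k) dx₀ dk₀) / (∬ V(x₀,k₀)·p₀ᵏ(k₀) · q(x₀,k₀ ∣ x,k) dx₀ dk₀). -/
open MeasureTheory

/-- The proposal kernel
`q_α(k₀ ∣ k) = (2π(1/α − 1))^(−n/2) · exp(−‖k₀ − k/√α‖² / (2(1/α − 1)))`. -/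
noncomputable def propQ (n : ℕ) (α : ℝ) (k₀ k : EuclideanSpace ℝ (Fin n)) : ℝ :=
  (2 * Real.pi * (1 / α - 1)) ^ (-(n : ℝ) / 2) *
    Real.exp (-‖k₀ - (Real.sqrt α)⁻¹ • k‖ ^ 2 / (2 * (1 / α - 1)))

/-- The clean joint density of the JM2D setup, `p₀(x₀,k₀) = C·p₀ˣ(x₀)·p₀ᵏ(k₀)·V(x₀,k₀)`. -/
noncomputable def cleanJoint (nx nk : ℕ) (C : ℝ)
    (p0x : EuclideanSpace ℝ (Fin nx) → ℝ) (p0k : EuclideanSpace ℝ (Fin nk) → ℝ)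
    (V : EuclideanSpace ℝ (Fin nx) × EuclideanSpace ℝ (Fin nk) → ℝ)
    (z : EuclideanSpace ℝ (Fin nx) × EuclideanSpace ℝ (Fin nk)) : ℝ :=
  C * p0x z.1 * p0k z.2 * V z

/-- The joint noisy density `p_i(x,k) = ∬ Kˣ(x ∣ x₀)·Kᵏ(k ∣ k₀)·p₀(x₀,k₀) dx₀ dk₀`. -/
noncomputable def noisyJoint (nx nk : ℕ) (αx αk C : ℝ)
    (p0x : EuclideanSpace ℝ (Fin nx) → ℝ) (p0k : EuclideanSpace ℝ (Fin nk) → ℝ)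
    (V : EuclideanSpace ℝ (Fin nx) × EuclideanSpace ℝ (Fin nk) → ℝ)
    (x : EuclideanSpace ℝ (Fin nx)) (k : EuclideanSpace ℝ (Fin nk)) : ℝ :=
  ∫ z₀ : EuclideanSpace ℝ (Fin nx) × EuclideanSpace ℝ (Fin nk),
    fwdK nx αx x z₀.1 * fwdK nk αk k z₀.2 * cleanJoint nx nk C p0x p0k V z₀

/-- The model-free noisy density `p_iˣ(x) = ∫ Kˣ(x ∣ x₀)·p₀ˣ(x₀) dx₀`. -/
noncomputable def noisyX (nx : ℕ) (αx : ℝ)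
    (p0x : EuclideanSpace ℝ (Fin nx) → ℝ) (x : EuclideanSpace ℝ (Fin nx)) : ℝ :=
  ∫ x₀, fwdK nx αx x x₀ * p0x x₀

/-- The JM2D proposal
`q(x₀,k₀ ∣ x,k) = (Kˣ(x ∣ x₀)·p₀ˣ(x₀)/p_iˣ(x))·qᵏ(k₀ ∣ k)`. -/
noncomputable def jointProposal (nx nk : ℕ) (αx αk : ℝ)
    (p0x : EuclideanSpace ℝ (Fin nx) → ℝ)
    (x : EuclideanSpace ℝ (Fin nx)) (k : EuclideanSpace ℝ (Fin nk))
    (z₀ : EuclideanSpace ℝ (Fin nx) × EuclideanSpace ℝ (Fin nk)) : ℝ :=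
  (fwdK nx αx x z₀.1 * p0x z₀.1 / noisyX nx αx p0x x) * propQ nk αk z₀.2 k

/-- The forward kernel is `α ^ (-n / 2)` times the proposal kernel with its arguments swapped. -/
lemma fwdK_eq_mul_propQ (n : ℕ) {α : ℝ} (hα : α ∈ Set.Ioo (0 : ℝ) 1)
    (y y₀ : EuclideanSpace ℝ (Fin n)) :
    fwdK n α y y₀ = α ^ (-(n : ℝ) / 2) * propQ n α y₀ y := by
  obtain ⟨h0, h1⟩ := hα
  have hs : 0 < Real.sqrt α := Real.sqrt_pos.2 h0
  have hinv : 0 < 1 / α - 1 := sub_pos.2 ((one_lt_div h0).2 h1)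
  have hvar : 2 * Real.pi * (1 - α) = α * (2 * Real.pi * (1 / α - 1)) := by
    field_simp
  have hnorm : ‖y - Real.sqrt α • y₀‖ ^ 2 = α * ‖y₀ - (Real.sqrt α)⁻¹ • y‖ ^ 2 := by
    have hvec : y - Real.sqrt α • y₀ = -(Real.sqrt α • (y₀ - (Real.sqrt α)⁻¹ • y)) := by
      rw [smul_sub, smul_inv_smul₀ hs.ne', neg_sub]
    rw [hvec, norm_neg, norm_smul, mul_pow, Real.norm_of_nonneg hs.le, Real.sq_sqrt h0.le]
  have hexp : -‖y - Real.sqrt α • y₀‖ ^ 2 / (2 * (1 - α)) =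
      -‖y₀ - (Real.sqrt α)⁻¹ • y‖ ^ 2 / (2 * (1 / α - 1)) := by
    have hden : 2 * (1 - α) = α * (2 * (1 / α - 1)) := by field_simp
    rw [hnorm, hden, ← mul_neg, mul_div_mul_left _ _ h0.ne']
  rw [fwdK, propQ, hexp, hvar, Real.mul_rpow h0.le (by positivity), mul_assoc]

/-- The integrand of the joint noisy density is a constant multiple of the importance weight
times the proposal. -/
lemma fwdK_mul_fwdK_mul_cleanJoint (nx nk : ℕ) (αx : ℝ) {αk : ℝ} (C : ℝ)
    (hαk : αk ∈ Set.Ioo (0 : ℝ) 1)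
    (p0x : EuclideanSpace ℝ (Fin nx) → ℝ) (p0k : EuclideanSpace ℝ (Fin nk) → ℝ)
    (V : EuclideanSpace ℝ (Fin nx) × EuclideanSpace ℝ (Fin nk) → ℝ)
    (x : EuclideanSpace ℝ (Fin nx)) (k : EuclideanSpace ℝ (Fin nk))
    (hpix : noisyX nx αx p0x x ≠ 0)
    (z₀ : EuclideanSpace ℝ (Fin nx) × EuclideanSpace ℝ (Fin nk)) :
    fwdK nx αx x z₀.1 * fwdK nk αk k z₀.2 * cleanJoint nx nk C p0x p0k V z₀ =
      (C * noisyX nx αx p0x x * αk ^ (-(nk : ℝ) / 2)) *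
        (V z₀ * p0k z₀.2 * jointProposal nx nk αx αk p0x x k z₀) := by
  rw [fwdK_eq_mul_propQ nk hαk, cleanJoint, jointProposal]
  field_simp

/-- The gradient of a logarithm is the logarithmic derivative. -/
lemma gradient_log {E : Type*} [NormedAddCommGroup E] [InnerProductSpace ℝ E] [CompleteSpace E]
    {f : E → ℝ} {a : E} (hf : DifferentiableAt ℝ f a) (ha : f a ≠ 0) :
    gradient (fun y => Real.log (f y)) a = (f a)⁻¹ • gradient f a := by
  rw [gradient, gradient, fderiv.log hf ha, map_smul]

/-- Theorem 1 (Joint score approximation using importance sampling): under the joint JM2D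
setup, at a noisy point `(x,k)` with `p_iˣ(x) > 0` and `p_i(x,k) > 0`, assuming `p_i` is
differentiable at `(x,k)` with gradient obtained by differentiating under the integral and
the stated integrability conditions, the joint score equals the importance-weighted ratio
`∇ log p_i (x,k) = (∬ (sˣ,sᵏ)·V·p₀ᵏ·q) / (∬ V·p₀ᵏ·q)`.
The joint space carries the ℓ²-product (Euclidean) structure `WithLp 2 (ℝ^{n_x} × ℝ^{n_k})`. -/
theorem jm2d_joint_score_importance_sampling
    (nx nk : ℕ) (αx αk : ℝ)
    (hαx : αx ∈ Set.Ioo (0 : ℝ) 1) (hαk : αk ∈ Set.Ioo (0 : ℝ) 1)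
    (p0x : EuclideanSpace ℝ (Fin nx) → ℝ) (p0k : EuclideanSpace ℝ (Fin nk) → ℝ)
    (V : EuclideanSpace ℝ (Fin nx) × EuclideanSpace ℝ (Fin nk) → ℝ)
    (C : ℝ) (hC : 0 < C)
    (hp0x_pos : ∀ x₀, 0 < p0x x₀) (hp0x_meas : Measurable p0x)
    (hp0x_one : (∫ x₀, p0x x₀) = 1)
    (hp0k_nonneg : ∀ k₀, 0 ≤ p0k k₀) (hp0k_meas : Measurable p0k)
    (hp0k_one : (∫ k₀, p0k k₀) = 1)
    (hV_nonneg : ∀ z, 0 ≤ V z) (hV_meas : Measurable V)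
    (x : EuclideanSpace ℝ (Fin nx)) (k : EuclideanSpace ℝ (Fin nk))
    (hpix : 0 < noisyX nx αx p0x x)
    (hpi : 0 < noisyJoint nx nk αx αk C p0x p0k V x k)
    (hdiff : DifferentiableAt ℝ
      (fun y : WithLp 2 (EuclideanSpace ℝ (Fin nx) × EuclideanSpace ℝ (Fin nk)) =>
        noisyJoint nx nk αx αk C p0x p0k V
          ((WithLp.equiv 2 _) y).1 ((WithLp.equiv 2 _) y).2)
      ((WithLp.equiv 2 (EuclideanSpace ℝ (Fin nx) × EuclideanSpace ℝ (Fin nk))).symm (x, k)))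
    (hgrad : gradient
        (fun y : WithLp 2 (EuclideanSpace ℝ (Fin nx) × EuclideanSpace ℝ (Fin nk)) =>
          noisyJoint nx nk αx αk C p0x p0k V
            ((WithLp.equiv 2 _) y).1 ((WithLp.equiv 2 _) y).2)
        ((WithLp.equiv 2 (EuclideanSpace ℝ (Fin nx) × EuclideanSpace ℝ (Fin nk))).symm (x, k))
      = ∫ z₀ : EuclideanSpace ℝ (Fin nx) × EuclideanSpace ℝ (Fin nk),
          (fwdK nx αx x z₀.1 * fwdK nk αk k z₀.2 * cleanJoint nx nk C p0x p0k V z₀) •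
            (WithLp.equiv 2 (EuclideanSpace ℝ (Fin nx) × EuclideanSpace ℝ (Fin nk))).symm
              (tweedieScore nx αx z₀.1 x, tweedieScore nk αk z₀.2 k))
    (hint_w : Integrable
      (fun z₀ : EuclideanSpace ℝ (Fin nx) × EuclideanSpace ℝ (Fin nk) =>
        V z₀ * p0k z₀.2 * jointProposal nx nk αx αk p0x x k z₀))
    (hint_sw : Integrable
      (fun z₀ : EuclideanSpace ℝ (Fin nx) × EuclideanSpace ℝ (Fin nk) =>
        (V z₀ * p0k z₀.2 * jointProposal nx nk αx αk p0x x k z₀) •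
          (WithLp.equiv 2 (EuclideanSpace ℝ (Fin nx) × EuclideanSpace ℝ (Fin nk))).symm
            (tweedieScore nx αx z₀.1 x, tweedieScore nk αk z₀.2 k)))
    (hw_pos : 0 < ∫ z₀ : EuclideanSpace ℝ (Fin nx) × EuclideanSpace ℝ (Fin nk),
        V z₀ * p0k z₀.2 * jointProposal nx nk αx αk p0x x k z₀) :
    gradient
        (fun y : WithLp 2 (EuclideanSpace ℝ (Fin nx) × EuclideanSpace ℝ (Fin nk)) =>
          Real.log (noisyJoint nx nk αx αk C p0x p0k V
            ((WithLp.equiv 2 _) y).1 ((WithLp.equiv 2 _) y).2))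
        ((WithLp.equiv 2 (EuclideanSpace ℝ (Fin nx) × EuclideanSpace ℝ (Fin nk))).symm (x, k))
      = (∫ z₀ : EuclideanSpace ℝ (Fin nx) × EuclideanSpace ℝ (Fin nk),
            V z₀ * p0k z₀.2 * jointProposal nx nk αx αk p0x x k z₀)⁻¹ •
          ∫ z₀ : EuclideanSpace ℝ (Fin nx) × EuclideanSpace ℝ (Fin nk),
            (V z₀ * p0k z₀.2 * jointProposal nx nk αx αk p0x x k z₀) •
              (WithLp.equiv 2 (EuclideanSpace ℝ (Fin nx) × EuclideanSpace ℝ (Fin nk))).symm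
                (tweedieScore nx αx z₀.1 x, tweedieScore nk αk z₀.2 k) := by
  rw [gradient_log hdiff hpi.ne', hgrad]
  have hint := fwdK_mul_fwdK_mul_cleanJoint nx nk αx C hαk p0x p0k V x k hpix.ne'
  set D := C * noisyX nx αx p0x x * αk ^ (-(nk : ℝ) / 2)
  have hD : D ≠ 0 := (mul_pos (mul_pos hC hpix) (Real.rpow_pos_of_pos hαk.1 _)).ne'
  have hjoint : noisyJoint nx nk αx αk C p0x p0k V x k =
      D * ∫ z₀ : EuclideanSpace ℝ (Fin nx) × EuclideanSpace ℝ (Fin nk),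
        V z₀ * p0k z₀.2 * jointProposal nx nk αx αk p0x x k z₀ := by
    simp only [noisyJoint, hint]
    exact integral_const_mul _ _
  simp only [Equiv.apply_symm_apply, hjoint, hint, mul_smul D, integral_smul]
  rw [mul_inv_rev, mul_smul, inv_smul_smul₀ hD]
end
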